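/- arXiv:math/0003242 — 3 statements merged into one kernel-verified Lean document; each statement's English description precedes it below -/
import Mathlib

section
/- Let M : ℝ → ℕ be a function whose support is a finite set of integers ≥ 1, let irr : ℝ → ℕ, and let ε₀ ∈ {0,1}. Assume: (i) for every real s > 0 with s ≠ 1/2, M(2s−1) = M(2s+1) + irr(s); (ii) M(2) + irr(1/2) = ε₀; (iii) M(1) + irr(0) + ε₀ = 1. Then there exists exactly one real s₀ ≥ 0 with irr(s₀) ≠ 0, and for this s₀ one has irr(s₀) = 1. Moreover: if M is not identically zero and a_max denotes the largest integer in the support of M, then s₀ = (a_max + 1)/2; if M is identically zero, then s₀ = 1/2 when ε₀ = 1 and s₀ = 0 when ε₀ = 0. -/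
/-- An antitone sequence of naturals starting at `1` and vanishing somewhere is the indicator
function of an initial segment. -/
theorem exists_eq_ite_le_of_antitone {P : ℕ → ℕ} (hP : Antitone P) (h0 : P 0 = 1)
    (hz : ∃ n, P n = 0) : ∃ k, ∀ n, P n = if n ≤ k then 1 else 0 := by
  classical
  have hpos : Nat.find hz ≠ 0 := fun h => by
    have := Nat.find_spec hz
    rw [h] at this
    omega
  refine ⟨Nat.find hz - 1, fun n => ?_⟩
  have hle : P n ≤ P 0 := hP (Nat.zero_le n)
  split_ifs with hn
  · have := Nat.find_min hz (show n < Nat.find hz by omega)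
    omega
  · have : P n ≤ P (Nat.find hz) := hP (by omega)
    rw [Nat.find_spec hz] at this
    omega

/-- A function on `ℝ` of finite support vanishes at some point of any arithmetic progression of
common difference `2`. -/
theorem exists_eq_zero_of_finite_support {M : ℝ → ℕ} (hM : (Function.support M).Finite)
    (c : ℝ) : ∃ n : ℕ, n ≠ 0 ∧ M (c + 2 * n) = 0 := by
  obtain ⟨B, hB⟩ := hM.bddAbove
  obtain ⟨n, hn⟩ := exists_nat_gt (max (B - c) 0)
  have hn1 := (le_max_left _ _).trans_lt hn
  have hn0 := (le_max_right _ _).trans_lt hn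
  refine ⟨n, by rintro rfl; simp at hn0, ?_⟩
  by_contra h
  have := hB (Function.mem_support.mpr h)
  linarith

/-- Combinatorial core of the main Theorem of Mœglin's paper (Sections 2.2–2.3), self-dual
case: under the relations `M (2s-1) = M (2s+1) + irr s` (`s > 0`, `s ≠ 1/2`),
`M 2 + irr (1/2) = ε₀` and `M 1 + irr 0 + ε₀ = 1`, there is exactly one `s₀ ≥ 0` with
`irr s₀ ≠ 0`; there `irr s₀ = 1`, and `s₀ = (a_max + 1)/2` where `a_max` is the largest
element of the support of `M` if `M ≠ 0`, while if `M = 0` then `s₀ = 1/2` when `ε₀ = 1`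
and `s₀ = 0` when `ε₀ = 0`. -/
theorem stmt2 (M irr : ℝ → ℕ) (ε₀ : ℕ)
    (hsupp : (Function.support M).Finite)
    (hint : ∀ s : ℝ, M s ≠ 0 → ∃ a : ℕ, 1 ≤ a ∧ s = (a : ℝ))
    (hε : ε₀ = 0 ∨ ε₀ = 1)
    (h1 : ∀ s : ℝ, 0 < s → s ≠ 1 / 2 → M (2 * s - 1) = M (2 * s + 1) + irr s)
    (h2 : M 2 + irr (1 / 2) = ε₀)
    (h3 : M 1 + irr 0 + ε₀ = 1) :
    (∃! s₀ : ℝ, 0 ≤ s₀ ∧ irr s₀ ≠ 0) ∧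
    ∀ s₀ : ℝ, 0 ≤ s₀ → irr s₀ ≠ 0 →
      irr s₀ = 1 ∧
      (∀ a : ℝ, IsGreatest (Function.support M) a → s₀ = (a + 1) / 2) ∧
      ((∀ s : ℝ, M s = 0) → ((ε₀ = 1 → s₀ = 1 / 2) ∧ (ε₀ = 0 → s₀ = 0))) := by
  have hε' : (ε₀ : ℝ) = 0 ∨ (ε₀ : ℝ) = 1 := by exact_mod_cast hε
  set P : ℕ → ℕ := fun n => if n = 0 then 1 else M ((ε₀ - 1 : ℝ) + 2 * n) with hPdef
  set Q : ℕ → ℕ := fun n => if n = 0 then 0 else M ((-ε₀ : ℝ) + 2 * n) with hQdef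
  have hP0 : P 0 = 1 := by simp [hPdef]
  have hQ0 : Q 0 = 0 := by simp [hQdef]
  have hPM : ∀ n : ℕ, n ≠ 0 → P n = M ((ε₀ - 1 : ℝ) + 2 * n) := fun n hn => by simp [hPdef, hn]
  have hQM : ∀ n : ℕ, n ≠ 0 → Q n = M ((-ε₀ : ℝ) + 2 * n) := fun n hn => by simp [hQdef, hn]
  have step : ∀ (c : ℝ) (n : ℕ), (c = 0 ∨ c = 1) → n ≠ 0 →
      M (c - 1 + 2 * n) = M (c - 1 + 2 * (n + 1 : ℕ)) + irr (c / 2 + n) := by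
    intro c n hc hn
    have hn1 : (1 : ℝ) ≤ n := by exact_mod_cast Nat.one_le_iff_ne_zero.mpr hn
    have hc0 : 0 ≤ c := by rcases hc with rfl | rfl <;> norm_num
    have h := h1 (c / 2 + n) (by linarith) (by intro h; linarith)
    rw [show c - 1 + 2 * (n : ℝ) = 2 * (c / 2 + n) - 1 by ring, h]
    congr 2
    push_cast
    ring
  have hPstep : ∀ n : ℕ, P n = P (n + 1) + irr (ε₀ / 2 + n) := by
    intro n
    rw [hPM (n + 1) n.succ_ne_zero]
    rcases eq_or_ne n 0 with rfl | hn
    · rw [hP0]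
      rcases hε with rfl | rfl
      · norm_num
        omega
      · norm_num at h2 ⊢
        omega
    · rw [hPM n hn]
      exact step ε₀ n hε' hn
  have hQstep : ∀ n : ℕ, Q n = Q (n + 1) + irr ((1 - ε₀) / 2 + n) := by
    intro n
    rw [hQM (n + 1) n.succ_ne_zero]
    rcases eq_or_ne n 0 with rfl | hn
    · rw [hQ0]
      rcases hε with rfl | rfl
      · norm_num at h2 ⊢
        omega
      · norm_num
        omega
    · rw [hQM n hn]
      have h := step (1 - ε₀) n (by rcases hε' with h | h <;> simp [h]) hn
      rwa [show (1 - ε₀ - 1 : ℝ) = -ε₀ by ring] at h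
  have hQ : ∀ n, Q n = 0 := by
    intro n
    induction n with
    | zero => exact hQ0
    | succ n ih => have := hQstep n; omega
  obtain ⟨k, hk⟩ : ∃ k, ∀ n, P n = if n ≤ k then 1 else 0 := by
    refine exists_eq_ite_le_of_antitone
      (antitone_nat_of_succ_le fun n => by have := hPstep n; omega) hP0 ?_
    obtain ⟨n, hn, hz⟩ := exists_eq_zero_of_finite_support hsupp (ε₀ - 1)
    exact ⟨n, (hPM n hn).trans hz⟩
  have hirr : ∀ n : ℕ, irr (ε₀ / 2 + n) = if n = k then 1 else 0 := by
    intro n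
    have h := hPstep n
    rw [hk, hk] at h
    split_ifs at h ⊢ <;> omega
  have progression : ∀ m : ℕ, ∃ n : ℕ, (m : ℝ) = ε₀ + 2 * n ∨ (m : ℝ) = 1 - ε₀ + 2 * n := by
    intro m
    obtain ⟨n, hn⟩ := m.even_or_odd'
    refine ⟨n, ?_⟩
    rcases hε' with he | he <;> rcases hn with rfl | rfl <;> rw [he] <;> push_cast
    · left; ring
    · right; ring
    · right; ring
    · left; ring
  have key : ∀ s : ℝ, 0 ≤ s → irr s ≠ 0 → s = ε₀ / 2 + k := by
    intro s hs hne
    obtain ⟨m, hm⟩ : ∃ m : ℕ, 2 * s = m := by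
      rcases hs.eq_or_lt with rfl | hpos
      · exact ⟨0, by simp⟩
      by_cases hhalf : s = 1 / 2
      · exact ⟨1, by rw [hhalf]; norm_num⟩
      have h := h1 s hpos hhalf
      obtain ⟨a, -, ha⟩ := hint (2 * s - 1) (by omega)
      exact ⟨a + 1, by push_cast; linarith⟩
    obtain ⟨n, hn | hn⟩ := progression m
    · have hsn : s = ε₀ / 2 + n := by linarith
      rw [hsn, hirr] at hne
      rw [hsn, show n = k by simpa using hne]
    · have hsn : s = (1 - ε₀) / 2 + n := by linarith
      have h := hQstep n
      rw [hQ, hQ, ← hsn] at h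
      omega
  have hk1 : irr (ε₀ / 2 + k) = 1 := by simp [hirr]
  refine ⟨⟨ε₀ / 2 + k, ⟨by positivity, by simp [hk1]⟩, fun s hs => key s hs.1 hs.2⟩, ?_⟩
  intro s hs hne
  rw [key s hs hne]
  refine ⟨hk1, fun a ha => ?_, fun hM => ?_⟩
  · have hMa : M a ≠ 0 := ha.1
    obtain ⟨m, hm1, rfl⟩ := hint a hMa
    have hm1' : (1 : ℝ) ≤ m := by exact_mod_cast hm1
    obtain ⟨n, hn | hn⟩ := progression (m + 1)
    · push_cast at hn
      have hn0 : n ≠ 0 := by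
        rintro rfl
        rcases hε' with h | h <;> rw [h] at hn <;> norm_num at hn <;> linarith
      rw [show (m : ℝ) = ε₀ - 1 + 2 * n by linarith, ← hPM n hn0, hk] at hMa
      have hnk : n ≤ k := by simpa using hMa
      have hkM : M (ε₀ - 1 + 2 * k) ≠ 0 := by
        rw [← hPM k (by omega), hk]
        simp
      have hle := ha.2 (Function.mem_support.mpr hkM)
      have hnk' : (n : ℝ) ≤ k := by exact_mod_cast hnk
      linarith
    · push_cast at hn
      have hn0 : n ≠ 0 := by
        rintro rfl
        rcases hε' with h | h <;> rw [h] at hn <;> norm_num at hn <;> linarith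
      rw [show (m : ℝ) = -ε₀ + 2 * n by linarith, ← hQM n hn0] at hMa
      exact absurd (hQ n) hMa
  · have hk0 : k = 0 := by
      by_contra h
      have := hPM k h
      rw [hM, hk] at this
      simp at this
    subst hk0
    constructor <;> rintro rfl <;> norm_num
end

section
/- Let M : ℝ → ℕ be a function whose support is a finite set of integers ≥ 1, let irr : ℝ → ℕ, and let ε₀ ∈ {0,1}. Assume: (i) for every real s > 0 with s ≠ 1/2, M(2s−1) = M(2s+1) + irr(s); (ii) M(2) + irr(1/2) = ε₀; (iii) M(1) + irr(0) + ε₀ = 1; and assume M is not identically zero. Then: (a) M(a) ≤ 1 for every a (M is without multiplicity); (b) for every integer a > 2 with M(a) ≥ 1 one has M(a−2) ≥ 1 (the support is without gaps); (c) if ε₀ = 1 then every integer in the support of M is even, and if ε₀ = 0 then every integer in the support of M is odd (the parity condition). -/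
/-- A sequence that does not increase in steps of two from `1` on is bounded by its value
at `1` on odd integers and by its value at `2` on positive even integers. -/
theorem le_one_and_le_two_of_add_two_le (f : ℕ → ℕ) (hf : ∀ n, 1 ≤ n → f (n + 2) ≤ f n)
    (k : ℕ) : f (2 * k + 1) ≤ f 1 ∧ f (2 * k + 2) ≤ f 2 := by
  induction k with
  | zero => exact ⟨le_rfl, le_rfl⟩
  | succ k ih =>
    exact ⟨(hf (2 * k + 1) (by lia)).trans ih.1, (hf (2 * k + 2) (by lia)).trans ih.2⟩


/-- Combinatorial core of the Proposition of the introduction of Mœglin's paper (proved in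
Section 2.3): under the relations of Section 2.2 and assuming `M` is not identically zero,
the multiset described by `M` is without multiplicity (`M a ≤ 1`), without gaps
(`a > 2` in the support implies `a - 2` in the support), and satisfies the parity
condition: its support consists of even integers when `ε₀ = 1` and of odd integers when
`ε₀ = 0`. -/
theorem stmt3 (M irr : ℝ → ℕ) (ε₀ : ℕ)
    (hsupp : (Function.support M).Finite)
    (hint : ∀ s : ℝ, M s ≠ 0 → ∃ a : ℕ, 1 ≤ a ∧ s = (a : ℝ))
    (hε : ε₀ = 0 ∨ ε₀ = 1)
    (h1 : ∀ s : ℝ, 0 < s → s ≠ 1 / 2 → M (2 * s - 1) = M (2 * s + 1) + irr s)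
    (h2 : M 2 + irr (1 / 2) = ε₀)
    (h3 : M 1 + irr 0 + ε₀ = 1)
    (hne : ∃ s : ℝ, M s ≠ 0) :
    (∀ s : ℝ, M s ≤ 1) ∧
    (∀ a : ℤ, 2 < a → 1 ≤ M (a : ℝ) → 1 ≤ M ((a : ℝ) - 2)) ∧
    (ε₀ = 1 → ∀ a : ℤ, M (a : ℝ) ≠ 0 → Even a) ∧
    (ε₀ = 0 → ∀ a : ℤ, M (a : ℝ) ≠ 0 → Odd a) := by
  have step (t : ℝ) (ht : 0 < t) : M (t + 2) ≤ M t := by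
    have h := h1 ((t + 1) / 2) (by linarith) (by intro h; linarith)
    rw [show 2 * ((t + 1) / 2) - 1 = t by ring,
      show 2 * ((t + 1) / 2) + 1 = t + 2 by ring] at h
    lia
  have bound := le_one_and_le_two_of_add_two_le (fun n => M n) fun n hn => by
    simpa using step n (by exact_mod_cast hn)
  simp only [Nat.cast_one, Nat.cast_ofNat] at bound
  have key (n : ℕ) (hn : 1 ≤ n) : M n ≤ 1 ∧ (M n ≠ 0 → (Even n ↔ ε₀ = 1)) := by
    obtain ⟨k, rfl | rfl⟩ : ∃ k, n = 2 * k + 1 ∨ n = 2 * k + 2 := ⟨(n - 1) / 2, by lia⟩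
    · have hk := (bound k).1
      refine ⟨by lia, fun h => iff_of_false (by grind) (by lia)⟩
    · have hk := (bound k).2
      refine ⟨by lia, fun h => iff_of_true (by grind) (by lia)⟩
  have parity (a : ℤ) (ha : M (a : ℝ) ≠ 0) : Even a ↔ ε₀ = 1 := by
    obtain ⟨n, hn, han⟩ := hint a ha
    obtain rfl : a = n := by exact_mod_cast han
    rw [Int.even_coe_nat]
    exact (key n hn).2 (by simpa using ha)
  refine ⟨fun s => ?_, fun a ha h => ?_, fun hε a ha => (parity a ha).2 hε, fun hε a ha => ?_⟩
  · by_cases hs : M s = 0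
    · lia
    · obtain ⟨n, hn, rfl⟩ := hint s hs
      exact (key n hn).1
  · have ha' : (2 : ℝ) < a := by exact_mod_cast ha
    have := step (a - 2) (by linarith)
    rw [sub_add_cancel] at this
    exact h.trans this
  · rw [← Int.not_even_iff_odd, parity a ha]
    lia
end

section
/- Let K and K' be finite multisets of pairs (x, a) ∈ ℝ × ℕ such that every element (x,a) of K or of K' satisfies −1/2 < x < 1/2, x ≠ 0, and a ≥ 1, and such that both K and K' are symmetric, i.e. for every pair (x,a), the multiplicity of (x,a) in K equals the multiplicity of (−x,a) in K, and likewise for K'. For such a multiset L define f_L : ℝ → ℤ by f_L(y) = (number of elements (x,a) of L, counted with multiplicity, with x + (a+1)/2 = y) − (number of elements (x,a) of L, counted with multiplicity, with x + (a−1)/2 = y). If f_K = f_{K'} as functions on ℝ, then K = K' as multisets. -/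
open scoped Classical

/-- On a multiset of pairs with first coordinate in `(-1/2, 1/2)`, the fibre of `(x, a) ↦ x + a / 2`
over `t + k / 2`, with `0 < t < 1/2`, consists of copies of `(t, k)` and of `(t - 1/2, k + 1)`. -/
lemma card_filter_add_half_eq (L : Multiset (ℝ × ℕ))
    (hL : ∀ p ∈ L, -(1 / 2 : ℝ) < p.1 ∧ p.1 < 1 / 2) {t : ℝ} (ht : 0 < t) (ht' : t < 1 / 2)
    (k : ℕ) :
    (L.filter (fun p => p.1 + (p.2 : ℝ) / 2 = t + (k : ℝ) / 2)).card
      = L.count (t, k) + L.count (t - 1 / 2, k + 1) := by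
  have key : L.filter (fun p => p.1 + (p.2 : ℝ) / 2 = t + (k : ℝ) / 2)
      = L.filter (fun p => p = (t, k) ∨ p = (t - 1 / 2, k + 1)) := by
    refine Multiset.filter_congr ?_
    rintro ⟨x, a⟩ hp
    obtain ⟨h1, h2⟩ := hL _ hp
    simp only [Prod.mk.injEq] at h1 h2 ⊢
    constructor
    · intro h
      have h3 : (a : ℝ) < k + 2 := by linarith
      have h4 : (k : ℝ) < a + 1 := by linarith
      have h5 : a < k + 2 := by exact_mod_cast h3
      have h6 : k < a + 1 := by exact_mod_cast h4
      obtain rfl | rfl : a = k ∨ a = k + 1 := by omega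
      · exact Or.inl ⟨by linarith, rfl⟩
      · push_cast at h
        exact Or.inr ⟨by linarith, rfl⟩
    · rintro (⟨rfl, rfl⟩ | ⟨rfl, rfl⟩)
      · rfl
      · push_cast
        ring
  have hdisj : L.filter (fun p => p = (t, k) ∧ p = (t - 1 / 2, k + 1)) = 0 := by
    refine Multiset.filter_eq_nil.2 ?_
    rintro p - ⟨rfl, h⟩
    simp at h
  have h := Multiset.filter_add_filter (fun p => p = (t, k)) (fun p => p = (t - 1 / 2, k + 1)) L
  rw [hdisj, add_zero] at h
  rw [key, ← h, Multiset.card_add, Multiset.filter_eq', Multiset.filter_eq',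
    Multiset.card_replicate, Multiset.card_replicate]

/-- The second coordinates of the elements of a multiset of pairs are bounded. -/
lemma exists_count_eq_zero_of_le (L : Multiset (ℝ × ℕ)) :
    ∃ N : ℕ, ∀ (x : ℝ) (a : ℕ), N ≤ a → L.count (x, a) = 0 := by
  refine ⟨L.toFinset.sup Prod.snd + 1, fun x a ha => Multiset.count_eq_zero.2 fun h => ?_⟩
  have : a ≤ L.toFinset.sup Prod.snd :=
    Finset.le_sup (f := Prod.snd) (Multiset.mem_toFinset.2 h)
  omega

/-- An eventually vanishing sequence with period two vanishes. -/
lemma eq_zero_of_eq_add_two {u : ℕ → ℤ} {N : ℕ} (hN : ∀ n, N ≤ n → u n = 0)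
    (hu : ∀ n, u n = u (n + 2)) (n : ℕ) : u n = 0 := by
  have h : ∀ j, u n = u (n + 2 * j) := by
    intro j
    induction j with
    | zero => rfl
    | succ j ih => rw [ih, hu, mul_add, mul_one, add_assoc]
  rw [h N]
  exact hN _ (by omega)

/-- Combinatorial injectivity lemma underlying Proposition 4.4 of Mœglin's paper: a finite
multiset `K` of pairs `(x, a)` with `-1/2 < x < 1/2`, `x ≠ 0`, `a ≥ 1`, symmetric under
`(x, a) ↦ (-x, a)`, is determined by the function
`y ↦ #{(x,a) ∈ K : x + (a+1)/2 = y} - #{(x,a) ∈ K : x + (a-1)/2 = y}`. -/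
theorem stmt5 (K K' : Multiset (ℝ × ℕ))
    (hK : ∀ p ∈ K, -(1 / 2 : ℝ) < p.1 ∧ p.1 < 1 / 2 ∧ p.1 ≠ 0 ∧ 1 ≤ p.2)
    (hK' : ∀ p ∈ K', -(1 / 2 : ℝ) < p.1 ∧ p.1 < 1 / 2 ∧ p.1 ≠ 0 ∧ 1 ≤ p.2)
    (symK : ∀ (x : ℝ) (a : ℕ), K.count (x, a) = K.count (-x, a))
    (symK' : ∀ (x : ℝ) (a : ℕ), K'.count (x, a) = K'.count (-x, a))
    (hf : ∀ y : ℝ,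
      ((K.filter (fun p => p.1 + ((p.2 : ℝ) + 1) / 2 = y)).card : ℤ)
          - ((K.filter (fun p => p.1 + ((p.2 : ℝ) - 1) / 2 = y)).card : ℤ)
        = ((K'.filter (fun p => p.1 + ((p.2 : ℝ) + 1) / 2 = y)).card : ℤ)
          - ((K'.filter (fun p => p.1 + ((p.2 : ℝ) - 1) / 2 = y)).card : ℤ)) :
    K = K' := by
  obtain ⟨N, hN⟩ := exists_count_eq_zero_of_le K
  obtain ⟨N', hN'⟩ := exists_count_eq_zero_of_le K'
  set c : ℝ → ℕ → ℤ := fun x a => (K.count (x, a) : ℤ) - K'.count (x, a) with hc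
  have c_symm : ∀ x a, c x a = c (-x) a := fun x a => by
    simp only [hc, symK x a, symK' x a]
  have c_large : ∀ x a, N + N' ≤ a → c x a = 0 := fun x a ha => by
    simp only [hc, hN x a (by omega), hN' x a (by omega)]
    rfl
  have hfib : ∀ t : ℝ, 0 < t → t < 1 / 2 → ∀ n : ℕ,
      c t n + c (1 / 2 - t) (n + 1) = c t (n + 2) + c (1 / 2 - t) (n + 3) := by
    intro t ht ht' n
    have h := hf (t + ((n : ℝ) + 1) / 2)
    have e1 : ∀ p : ℝ × ℕ, p.1 + ((p.2 : ℝ) + 1) / 2 = t + ((n : ℝ) + 1) / 2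
        ↔ p.1 + (p.2 : ℝ) / 2 = t + (n : ℝ) / 2 := fun p => by
      constructor <;> intro h <;> linarith
    have e2 : ∀ p : ℝ × ℕ, p.1 + ((p.2 : ℝ) - 1) / 2 = t + ((n : ℝ) + 1) / 2
        ↔ p.1 + (p.2 : ℝ) / 2 = t + ((n + 2 : ℕ) : ℝ) / 2 := fun p => by
      push_cast
      constructor <;> intro h <;> linarith
    have hL : ∀ p ∈ K, -(1 / 2 : ℝ) < p.1 ∧ p.1 < 1 / 2 :=
      fun p hp => ⟨(hK p hp).1, (hK p hp).2.1⟩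
    have hL' : ∀ p ∈ K', -(1 / 2 : ℝ) < p.1 ∧ p.1 < 1 / 2 :=
      fun p hp => ⟨(hK' p hp).1, (hK' p hp).2.1⟩
    simp only [e1, e2, card_filter_add_half_eq K hL ht ht',
      card_filter_add_half_eq K' hL' ht ht'] at h
    push_cast at h
    rw [c_symm (1 / 2 - t), c_symm (1 / 2 - t), neg_sub]
    simp only [hc]
    linarith
  have hsum : ∀ t : ℝ, 0 < t → t < 1 / 2 → ∀ n : ℕ, c t n + c (1 / 2 - t) (n + 1) = 0 :=
    fun t ht ht' => eq_zero_of_eq_add_two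
      (fun n hn => by rw [c_large _ _ hn, c_large _ _ (by omega), add_zero]) (hfib t ht ht')
  have hpos : ∀ t : ℝ, 0 < t → t < 1 / 2 → ∀ n : ℕ, c t n = 0 := by
    intro t ht ht'
    refine eq_zero_of_eq_add_two (c_large t) fun n => ?_
    have h1 := hsum t ht ht' n
    have h2 := hsum (1 / 2 - t) (by linarith) (by linarith) (n + 1)
    rw [sub_sub_cancel] at h2
    linarith
  have hzero : ∀ x a, -(1 / 2 : ℝ) < x → x < 1 / 2 → x ≠ 0 → c x a = 0 := by
    intro x a h1 h2 h3
    rcases lt_or_gt_of_ne h3 with h | h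
    · rw [c_symm]
      exact hpos _ (by linarith) (by linarith) a
    · exact hpos _ h h2 a
  ext ⟨x, a⟩
  by_cases h : -(1 / 2 : ℝ) < x ∧ x < 1 / 2 ∧ x ≠ 0
  · exact_mod_cast sub_eq_zero.1 (hzero x a h.1 h.2.1 h.2.2)
  · rw [Multiset.count_eq_zero.2 fun hp => h ⟨(hK _ hp).1, (hK _ hp).2.1, (hK _ hp).2.2.1⟩,
      Multiset.count_eq_zero.2 fun hp => h ⟨(hK' _ hp).1, (hK' _ hp).2.1, (hK' _ hp).2.2.1⟩]
end
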